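/- Let k be a positive integer, set s = ⌈k/12⌉, let T be an antidirected tree with k arcs, and let D be a 𝒦_{2,s}-free digraph with more than (k−1)·|V(D)| arcs. If Δ(T) ≤ ⌊k/4⌋, then T embeds in D. -/

import Mathlib

open Finset

section Defs

variable {V W : Type*}

/-- Number of arcs of a digraph given by a Boolean adjacency relation. -/
def arcCount [Fintype V] (A : V → V → Bool) : ℕ :=
  ((univ : Finset (V × V)).filter (fun p => A p.1 p.2)).card

/-- Out-neighbourhood. -/
def outNbr [Fintype V] (A : V → V → Bool) (a : V) : Finset V :=
  univ.filter (fun v => A a v)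

/-- In-neighbourhood. -/
def inNbr [Fintype V] (A : V → V → Bool) (a : V) : Finset V :=
  univ.filter (fun v => A v a)

/-- Neighbourhood with a sign: `true` = out, `false` = in. -/
def nbr [Fintype V] (A : V → V → Bool) (sign : Bool) (a : V) : Finset V :=
  if sign then outNbr A a else inNbr A a

/-- Total degree (out-degree plus in-degree). -/
def totalDeg [Fintype V] (A : V → V → Bool) (a : V) : ℕ :=
  (outNbr A a).card + (inNbr A a).card

/-- Maximum total degree `Δ`. -/
def maxDeg [Fintype V] (A : V → V → Bool) : ℕ :=
  univ.sup (totalDeg A)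

/-- Second largest element `Δ₂` of the multiset of total degrees. -/
def secondMaxDeg [Fintype V] (A : V → V → Bool) : ℕ :=
  (((univ : Finset V).val.map (totalDeg A)).erase (maxDeg A)).sup

/-- Loopless digraph. -/
def Loopless (A : V → V → Bool) : Prop := ∀ v, ¬ A v v

/-- Antidirected digraph: no directed path with two arcs. -/
def Antidirected (A : V → V → Bool) : Prop := ∀ x y z, A x y → A y z → False

/-- The underlying (undirected) simple graph of a digraph. -/
def underG (A : V → V → Bool) : SimpleGraph V :=
  SimpleGraph.fromRel (fun x y => A x y)

/-- `𝒦_{2,s}`-freeness: no two distinct vertices `a`, `b` together with signs and `s`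
distinct vertices (all different from `a` and `b`) lying in both signed neighbourhoods. -/
def K2sFree [Fintype V] [DecidableEq V] (A : V → V → Bool) (s : ℕ) : Prop :=
  ¬ ∃ (a b : V) (sa sb : Bool) (S : Finset V), a ≠ b ∧ S.card = s ∧
      a ∉ S ∧ b ∉ S ∧ S ⊆ nbr A sa a ∩ nbr A sb b

/-- `T` embeds in `A`: there is an injective arc-preserving map. -/
def Embeds (T : W → W → Bool) (A : V → V → Bool) : Prop :=
  ∃ f : W → V, Function.Injective f ∧ ∀ x y, T x y → A (f x) (f y)

/-- Vertices of positive out-degree. -/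
def outVerts [Fintype V] (A : V → V → Bool) : Finset V :=
  univ.filter (fun v => (outNbr A v).card ≠ 0)

/-- Vertices of positive in-degree. -/
def inVerts [Fintype V] (A : V → V → Bool) : Finset V :=
  univ.filter (fun v => (inNbr A v).card ≠ 0)

/-- A caterpillar: a tree with a path such that every vertex is on the path
or adjacent to it. -/
def IsCaterpillarG {X : Type*} (G : SimpleGraph X) : Prop :=
  G.IsTree ∧ ∃ (x y : X) (P : G.Walk x y), P.IsPath ∧
    ∀ v, v ∈ P.support ∨ ∃ w ∈ P.support, G.Adj v w

/-- Minimum pseudo-semidegree at least `m`: at least one arc, and every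
out-degree and in-degree is `0` or at least `m`. -/
def MinPseudoSemidegGe [Fintype V] (A : V → V → Bool) (m : ℕ) : Prop :=
  0 < arcCount A ∧ (∀ v, (outNbr A v).card = 0 ∨ m ≤ (outNbr A v).card) ∧
    (∀ v, (inNbr A v).card = 0 ∨ m ≤ (inNbr A v).card)

/-- `D'` is a subdigraph of `D` with vertex set `S`. -/
def SubdigraphOn (D : V → V → Bool) (S : Finset V) (D' : V → V → Bool) : Prop :=
  ∀ x y, D' x y → D x y ∧ x ∈ S ∧ y ∈ S

/-- The vertex set of the double broom `B_{uv}(T)`: the path joining `u` and `v`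
together with all neighbours of `u` and all neighbours of `v`. -/
def broomSet [Fintype W] [DecidableEq W] (T : W → W → Bool) {u v : W}
    (p : (underG T).Walk u v) : Finset W :=
  p.support.toFinset ∪ (outNbr T u ∪ inNbr T u) ∪ (outNbr T v ∪ inNbr T v)

/-- `z` lies strictly after `x` and strictly before `y` in clockwise (cyclic) order
on `Fin n`. -/
def cycBetween {n : ℕ} (x y z : Fin n) : Prop :=
  if x < y then x < z ∧ z < y else x < z ∨ z < y

/-- An arc `pq` of the convex digraph `A` on `Fin n` is good for the antidirected
caterpillar `T` with final vertex `u`, its spine neighbour `v`, and spine with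
`plen` edges (so `plen + 1` spine vertices). -/
def GoodArc {n : ℕ} (A : Fin n → Fin n → Bool) (T : W → W → Bool)
    (u v : W) (plen : ℕ) (pq : Fin n × Fin n) : Prop :=
  ∃ f : W → Fin n, Function.Injective f ∧ (∀ x y, T x y → A (f x) (f y)) ∧
    ((T v u = true ∧ (f v, f u) = pq) ∨ (T u v = true ∧ (f u, f v) = pq)) ∧
    (∀ z : Fin n,
      (plen % 2 = 0 → cycBetween (f u) (f v) z → z ∉ Set.range f) ∧
      (plen % 2 = 1 → z ≠ f u → z ≠ f v → ¬ cycBetween (f u) (f v) z →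
        z ∉ Set.range f))

/-- Number of edges of a bipartite graph with parts `α`, `β`. -/
def bipArcCount {α β : Type*} [Fintype α] [Fintype β] (E : α → β → Bool) : ℕ :=
  ((univ : Finset (α × β)).filter (fun p => E p.1 p.2)).card

/-- Degree of a vertex of the `α` part. -/
def bipDegA {α β : Type*} [Fintype β] (E : α → β → Bool) (a : α) : ℕ :=
  (univ.filter (fun b => E a b)).card

/-- Degree of a vertex of the `β` part. -/
def bipDegB {α β : Type*} [Fintype α] (E : α → β → Bool) (b : β) : ℕ :=
  (univ.filter (fun a => E a b)).card

end Defs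

theorem second_moment_bound {k d σ τ : ℤ} (hd : 12 * d + 1 ≤ k) (hk : 13 ≤ k) (h3 : 3 ≤ σ) (h4 : 4 * σ ≤ k)
    (hτ : k ≤ 2 * (τ + σ - 1)) :
    (k + 1 - σ) * (τ + (σ - 1) * (d - 1)) < σ * τ ^ 2 := by
  have hT : 0 ≤ 2 * τ - (k - 2 * σ + 2) := by linarith
  have h1 : 0 ≤ (σ - 3) * (k - 4 * σ) := mul_nonneg (by linarith) (by linarith)
  have h0 : 0 ≤ σ * (k - 2 * σ + 2) - 2 * (k + 1 - σ) := by nlinarith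
  have h2 : (k - 2 * σ + 2) * (σ * (k - 2 * σ + 2) - 2 * (k + 1 - σ))
      ≤ 2 * τ * (σ * (2 * τ) - 2 * (k + 1 - σ)) := by
    have : 0 ≤ σ * (2 * τ - (k - 2 * σ + 2)) := mul_nonneg (by linarith) hT
    apply mul_le_mul <;> nlinarith
  have h5 : (k + 1 - σ) * (σ - 1) * (12 * (d - 1)) ≤ (k + 1 - σ) * (σ - 1) * (k - 13) :=
    mul_le_mul_of_nonneg_left (by linarith) (mul_nonneg (by linarith) (by linarith))
  have h6 : (k + 1 - σ) * (σ - 1) * (k - 13) <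
      3 * ((k - 2 * σ + 2) * (σ * (k - 2 * σ + 2) - 2 * (k + 1 - σ))) := by
    nlinarith [mul_nonneg h1 (show 0 ≤ k - 4 * σ by linarith),
      mul_nonneg h1 (show 0 ≤ σ - 3 by linarith), mul_nonneg h1 (show 0 ≤ k - 13 by linarith)]
  nlinarith

theorem first_moment_bound_of_le {k d κ σ g : ℤ} (hd : 12 * d + 1 ≤ k) (hk : 13 ≤ k) (hκ : 4 * κ ≤ k)
    (hκ' : k ≤ 4 * κ + 3) (hσ : σ ≤ κ + 1) (hg : κ + 1 ≤ g) :
    2 * d * (k + 1 - σ) < g * (k - 2 * (σ - 1)) := by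
  have h1 : (κ + 1) * (k - 2 * (σ - 1)) ≤ g * (k - 2 * (σ - 1)) :=
    mul_le_mul_of_nonneg_right hg (by linarith)
  have h2 : 12 * d * (k + 1 - σ) ≤ (k - 1) * (k + 1 - σ) :=
    mul_le_mul_of_nonneg_right (by linarith) (by linarith)
  nlinarith [mul_nonneg (show 0 ≤ κ + 1 - σ by linarith) (show 0 ≤ 12 * (κ + 1) - (k - 1) by linarith),
    mul_nonneg (show 0 ≤ k - 4 * κ by linarith) (show 0 ≤ 4 * κ + 3 - k by linarith)]

theorem first_moment_bound_of_lt {k d κ σ g : ℤ} (hd : 12 * d + 1 ≤ k) (hk : 13 ≤ k) (hκ : 4 * κ ≤ k)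
    (hκ' : k ≤ 4 * κ + 3) (hσ : κ + 2 ≤ σ) (hσ' : 2 * σ ≤ k + 1) (hg : σ + κ ≤ 2 * g) :
    2 * d * (k + 1 - σ) < g * (k - (σ + κ)) := by
  have h1 : (σ + κ) * (k - (σ + κ)) ≤ 2 * g * (k - (σ + κ)) :=
    mul_le_mul_of_nonneg_right hg (by linarith)
  have h2 : 12 * d * (k + 1 - σ) ≤ (k - 1) * (k + 1 - σ) :=
    mul_le_mul_of_nonneg_right (by linarith) (by linarith)
  have h3 : (k - 1) * (k + 1 - σ) < 3 * ((σ + κ) * (k - (σ + κ))) := by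
    nlinarith [mul_nonneg (show 0 ≤ σ - κ - 2 by linarith) (show 0 ≤ k + 1 - 2 * σ by linarith),
      mul_nonneg (show 0 ≤ k - 4 * κ by linarith) (show 0 ≤ 4 * κ + 3 - k by linarith),
      mul_nonneg (show 0 ≤ k - 13 by linarith) (show 0 ≤ 4 * κ + 3 - k by linarith),
      mul_nonneg (show 0 ≤ k - 13 by linarith) (show 0 ≤ k - 4 * κ by linarith),
      mul_nonneg (show 0 ≤ k - 13 by linarith) (show 0 ≤ σ - κ - 2 by linarith),
      mul_nonneg (show 0 ≤ k - 13 by linarith) (show 0 ≤ k + 1 - 2 * σ by linarith)]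
  nlinarith

/-- The signed neighbourhoods `N ε a` of a host digraph: non-empty ones have at least `k / 2`
elements and distinct vertices have at most `d` common neighbours. -/
structure IsHost {V : Type*} [DecidableEq V] (N : Bool → V → Finset V) (k d : ℕ) : Prop where
  symm : ∀ {ε a b}, b ∈ N ε a → a ∈ N (!ε) b
  irrefl : ∀ ε a, a ∉ N ε a
  deg : ∀ {ε a}, (N ε a).Nonempty → k ≤ 2 * (N ε a).card
  codeg : ∀ {a b} ε ε', a ≠ b → (N ε a ∩ N ε' b).card ≤ d

theorem sq_card_mul_le_of_inter_le {V : Type*} [DecidableEq V] {C K : Finset V}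
    {F : V → Finset V} {τ e : ℕ} (hC : C.Nonempty) (hF : ∀ b ∈ C, F b ⊆ K)
    (hτ : ∀ b ∈ C, (F b).card = τ)
    (he : ∀ b ∈ C, ∀ c ∈ C, b ≠ c → (F b ∩ F c).card ≤ e) :
    C.card * τ ^ 2 ≤ K.card * (τ + (C.card - 1) * e) := by
  have h1 : ∑ u ∈ K, ∑ b ∈ C, (if u ∈ F b then 1 else 0) = C.card * τ := by
    rw [sum_comm, ← smul_eq_mul, ← sum_const]
    refine sum_congr rfl fun b hb => ?_
    rw [← card_filter, filter_mem_eq_inter, inter_eq_right.2 (hF b hb), hτ b hb]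
  have h2 : ∑ u ∈ K, (∑ b ∈ C, (if u ∈ F b then 1 else 0)) ^ 2
      ≤ C.card * (τ + (C.card - 1) * e) := by
    have : ∀ u ∈ K, (∑ b ∈ C, (if u ∈ F b then 1 else 0)) ^ 2
        = ∑ b ∈ C, ∑ c ∈ C, (if u ∈ F b ∩ F c then 1 else 0) := by
      intro u _
      rw [sq, sum_mul_sum]
      refine sum_congr rfl fun b _ => sum_congr rfl fun c _ => ?_
      by_cases hb : u ∈ F b <;> by_cases hc : u ∈ F c <;> simp [hb, hc]
    rw [sum_congr rfl this, sum_comm, ← smul_eq_mul, ← sum_const]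
    refine sum_le_sum fun b hb => ?_
    rw [sum_comm, ← add_sum_erase _ _ hb]
    have hcount : ∀ c ∈ C, ∑ u ∈ K, (if u ∈ F b ∩ F c then 1 else 0) = (F b ∩ F c).card := by
      intro c hc
      rw [← card_filter, filter_mem_eq_inter, inter_eq_right.2]
      exact inter_subset_left.trans (hF b hb)
    rw [hcount b hb, inter_self, hτ b hb, ← card_erase_of_mem hb, ← smul_eq_mul, ← sum_const]
    refine Nat.add_le_add_left (sum_le_sum fun c hc => ?_) _
    rw [hcount c (mem_of_mem_erase hc)]
    exact he b hb c (mem_of_mem_erase hc) (ne_of_mem_erase hc).symm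
  have h3 := sq_sum_le_card_mul_sum_sq (s := K) (f := fun u => ∑ b ∈ C, (if u ∈ F b then 1 else 0))
  rw [h1] at h3
  have hpos := hC.card_pos
  refine Nat.le_of_mul_le_mul_left ?_ hpos
  calc C.card * (C.card * τ ^ 2) = (C.card * τ) ^ 2 := by ring
    _ ≤ K.card * (C.card * (τ + (C.card - 1) * e)) := h3.trans (Nat.mul_le_mul_left _ h2)
    _ = _ := by ring

theorem card_add_card_add_card_le {V : Type*} [DecidableEq V] {X Y Z K : Finset V} {d : ℕ}
    (hX : X ⊆ K) (hY : Y ⊆ K) (hZ : Z ⊆ K) (hXY : (X ∩ Y).card ≤ d) (hXZ : (X ∩ Z).card ≤ d)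
    (hYZ : (Y ∩ Z).card ≤ d) : X.card + Y.card + Z.card ≤ K.card + 3 * d := by
  have h1 := card_union_add_card_inter X Y
  have h2 := card_union_add_card_inter (X ∪ Y) Z
  have h3 := card_le_card (union_subset (union_subset hX hY) hZ)
  have h4 : ((X ∪ Y) ∩ Z).card ≤ (X ∩ Z).card + (Y ∩ Z).card := by
    rw [union_inter_distrib_right]; exact card_union_le _ _
  omega

namespace IsHost

variable {V : Type*} [DecidableEq V] {N : Bool → V → Finset V} {k d : ℕ}

theorem nonempty_of_mem (h : IsHost N k d) {ε : Bool} {a b : V} (hb : b ∈ N ε a) :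
    (N (!ε) b).Nonempty := ⟨a, h.symm hb⟩

theorem exists_le_card_sdiff_of_mul_lt (h : IsHost N k d) {ε : Bool} {a : V} {C Q : Finset V}
    {t : ℕ} (hC : C ⊆ N ε a) (ha : a ∈ Q)
    (hlt : (Q.card - 1) * d < C.card * ((k + 1) / 2 - t)) :
    ∃ b ∈ C, t ≤ (N (!ε) b \ Q).card := by
  by_contra! hcon
  refine hlt.not_ge ?_
  rw [← card_erase_of_mem ha]
  refine card_mul_le_card_mul (fun b u => u ∈ N (!ε) b) (fun b hb => ?_) (fun u hu => ?_)
  · have h1 := h.deg (h.nonempty_of_mem (hC hb))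
    have h2 := hcon b hb
    have h3 := card_sdiff_add_card_inter (N (!ε) b) Q
    have h4 : (N (!ε) b ∩ Q).card - 1 ≤
        (bipartiteAbove (fun b u => u ∈ N (!ε) b) (Q.erase a) b).card := by
      refine pred_card_le_card_erase.trans (card_le_card (s := (N (!ε) b ∩ Q).erase a) fun u hu => ?_)
      simp only [mem_erase, mem_inter] at hu
      simp [bipartiteAbove, hu]
    omega
  · refine (card_le_card fun b hb => ?_).trans (h.codeg ε ε (ne_of_mem_erase hu).symm)
    simp only [bipartiteBelow, mem_filter] at hb
    refine mem_inter.2 ⟨hC hb.1, ?_⟩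
    simpa using h.symm hb.2

theorem exists_le_card_sdiff_of_second_moment (h : IsHost N k d) {ε : Bool} {a : V} {U C Q : Finset V}
    {σ : ℕ} (hd : 12 * d + 1 ≤ k) (hk : 13 ≤ k) (hC : C = N ε a \ U) (hUQ : U ⊆ Q) (ha : a ∈ U)
    (hσ : 1 ≤ σ) (hσC : σ ≤ C.card) (hσk : 4 * σ ≤ k) (hQ : Q.card + σ ≤ k + 2)
    (hUC : σ = 2 → U.card + C.card ≤ k + 1 ∨ 3 ≤ C.card) :
    ∃ b ∈ C, σ - 1 ≤ (N (!ε) b \ Q).card := by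
  have hCN : C ⊆ N ε a := hC ▸ sdiff_subset
  by_contra! hcon
  obtain rfl | rfl | h3 : σ = 1 ∨ σ = 2 ∨ 3 ≤ σ := by omega
  · obtain ⟨b, hb⟩ : C.Nonempty := card_pos.1 (by omega)
    exact absurd (hcon b hb) (by simp)
  · have hsub : ∀ b ∈ C, N (!ε) b ⊆ Q := fun b hb => by
      have := hcon b hb
      rw [← sdiff_eq_empty_iff_subset, ← card_eq_zero]
      omega
    have hdeg : ∀ b ∈ C, k ≤ 2 * (N (!ε) b).card := fun b hb => h.deg (h.nonempty_of_mem (hCN hb))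
    by_cases hg : 3 ≤ C.card
    · obtain ⟨x, hx, y, hy, z, hz, hxy, hxz, hyz⟩ := two_lt_card.1 (show 2 < C.card by omega)
      have := card_add_card_add_card_le (hsub x hx) (hsub y hy) (hsub z hz)
        (h.codeg _ _ hxy) (h.codeg _ _ hxz) (h.codeg _ _ hyz)
      have h1 := hdeg x hx
      have h2 := hdeg y hy
      have h3 := hdeg z hz
      omega
    · obtain ⟨x, hx, y, hy, hxy⟩ := one_lt_card.1 (show 1 < C.card by omega)
      have hNa : N ε a ⊆ U ∪ C := by
        rw [hC, union_sdiff_self_eq_union]; exact subset_union_right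
      have hax : a ≠ x := by rintro rfl; exact h.irrefl _ _ (hCN hx)
      have hay : a ≠ y := by rintro rfl; exact h.irrefl _ _ (hCN hy)
      have := card_add_card_add_card_le (K := Q ∪ C)
        (hNa.trans (union_subset_union_left hUQ))
        ((hsub x hx).trans subset_union_left) ((hsub y hy).trans subset_union_left)
        (h.codeg _ _ hax) (h.codeg _ _ hay) (h.codeg _ _ hxy)
      have h1 := hdeg x hx
      have h2 := hdeg y hy
      have h3 := h.deg ⟨x, hCN hx⟩
      have h4 := card_union_le Q C
      omega
  · obtain ⟨C', hC', hcard⟩ := exists_subset_card_eq hσC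
    have haQ := hUQ ha
    have hF : ∀ b, ∃ F : Finset V, b ∈ C' → F ⊆ N (!ε) b ∩ Q.erase a ∧
        F.card = (k + 1) / 2 - σ + 1 := by
      intro b
      by_cases hb : b ∈ C'
      · have hbC := hC' hb
        have h1 := h.deg (h.nonempty_of_mem (hCN hbC))
        have h2 := hcon b hbC
        have h3 := card_sdiff_add_card_inter (N (!ε) b) Q
        have h4 : (N (!ε) b ∩ Q).card - 1 ≤ (N (!ε) b ∩ Q.erase a).card := by
          rw [inter_erase]; exact pred_card_le_card_erase
        obtain ⟨F, hF, hF'⟩ := exists_subset_card_eq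
          (show (k + 1) / 2 - σ + 1 ≤ (N (!ε) b ∩ Q.erase a).card by omega)
        exact ⟨F, fun _ => ⟨hF, hF'⟩⟩
      · exact ⟨∅, fun hb' => absurd hb' hb⟩
    choose F hF using hF
    have hpair : ∀ b ∈ C', ∀ c ∈ C', b ≠ c → (F b ∩ F c).card ≤ d - 1 := by
      intro b hb c hc hbc
      have h1 : F b ∩ F c ⊆ (N (!ε) b ∩ N (!ε) c).erase a := by
        intro u hu
        have h2 := (hF b hb).1 (mem_inter.1 hu).1
        have h3 := (hF c hc).1 (mem_inter.1 hu).2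
        simp only [mem_inter, mem_erase] at h2 h3 ⊢
        tauto
      refine (card_le_card h1).trans ?_
      rw [card_erase_of_mem]
      · exact Nat.sub_le_sub_right (h.codeg _ _ hbc) 1
      · exact mem_inter.2 ⟨h.symm (hCN (hC' hb)), h.symm (hCN (hC' hc))⟩
    have hd1 : 1 ≤ d := by
      obtain ⟨b, hb, c, hc, hbc⟩ := one_lt_card.1 (show 1 < C'.card by omega)
      refine le_trans (card_pos.2 ⟨a, ?_⟩) (h.codeg (!ε) (!ε) hbc)
      exact mem_inter.2 ⟨h.symm (hCN (hC' hb)), h.symm (hCN (hC' hc))⟩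
    have hmain := sq_card_mul_le_of_inter_le (K := Q.erase a) (card_pos.1 (by omega))
      (fun b hb => (hF b hb).1.trans inter_subset_right) (fun b hb => (hF b hb).2) hpair
    rw [hcard, card_erase_of_mem haQ] at hmain
    have hmain' : σ * ((k + 1) / 2 - σ + 1) ^ 2
        ≤ (k + 1 - σ) * ((k + 1) / 2 - σ + 1 + (σ - 1) * (d - 1)) :=
      hmain.trans (Nat.mul_le_mul_right _ (by omega))
    generalize hτ : (k + 1) / 2 - σ + 1 = τ at hmain'
    have := second_moment_bound (k := k) (d := d) (σ := σ) (τ := τ) (by omega) (by omega) (by omega)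
      (by omega) (by omega)
    zify [show σ ≤ k + 1 by omega, hσ, hd1] at hmain'
    linarith

theorem exists_le_card_sdiff_of_first_moment (h : IsHost N k d) {ε : Bool} {a : V} {C Q : Finset V}
    {σ : ℕ} (hd : 12 * d + 1 ≤ k) (hk : 13 ≤ k) (hC : C ⊆ N ε a) (ha : a ∈ Q)
    (hσ : 1 ≤ σ) (hQ : Q.card + σ ≤ k + 2) (hg : k / 4 + 1 ≤ C.card)
    (hg' : σ + k / 4 ≤ 2 * C.card) (hσk : 2 * σ ≤ k + 1) :
    ∃ b ∈ C, min (σ - 1) ((σ + k / 4) / 2) ≤ (N (!ε) b \ Q).card := by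
  refine h.exists_le_card_sdiff_of_mul_lt hC ha
    ((Nat.mul_le_mul_right _ (show Q.card - 1 ≤ k + 1 - σ by omega)).trans_lt ?_)
  generalize hκ : k / 4 = κ at *
  generalize C.card = g at *
  by_cases hs : σ ≤ κ + 1
  · have := first_moment_bound_of_le (k := k) (d := d) (σ := σ) (κ := κ) (g := g) (by omega) (by omega)
      (by omega) (by omega) (by omega) (by omega)
    rw [show min (σ - 1) ((σ + κ) / 2) = σ - 1 by omega]
    have h2 : g * (k - 2 * (σ - 1)) ≤ 2 * (g * ((k + 1) / 2 - (σ - 1))) := by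
      rw [mul_left_comm]; exact Nat.mul_le_mul_left _ (by omega)
    zify [show σ ≤ k + 1 by omega, show 2 * (σ - 1) ≤ k by omega, hσ,
      show σ - 1 ≤ (k + 1) / 2 by omega] at h2 ⊢
    linarith
  · have := first_moment_bound_of_lt (k := k) (d := d) (σ := σ) (κ := κ) (g := g) (by omega) (by omega)
      (by omega) (by omega) (by omega) (by omega) (by omega)
    rw [show min (σ - 1) ((σ + κ) / 2) = (σ + κ) / 2 by omega]
    have h2 : g * (k - (σ + κ)) ≤ 2 * (g * ((k + 1) / 2 - (σ + κ) / 2)) := by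
      rw [mul_left_comm]; exact Nat.mul_le_mul_left _ (by omega)
    have h3 : (2 * d * (k + 1 - σ) : ℕ) < g * (k - (σ + κ)) := by
      zify [show σ ≤ k + 1 by omega, show σ + κ ≤ k by omega]
      linarith
    rw [mul_comm (k + 1 - σ)]
    rw [mul_assoc] at h3
    omega

theorem exists_extension (h : IsHost N k d) {ε : Bool} {a : V} {U C : Finset V}
    {σ s r : ℕ} (hd : 12 * d + 1 ≤ k) (hk : 13 ≤ k) (hC : C = N ε a \ U) (ha : a ∈ U)
    (hσ : 1 ≤ σ) (hUs : U.card + s ≤ k + 1) (hrs : r + σ ≤ s) (hrC : r + 1 ≤ C.card)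
    (hcase : (4 * σ ≤ k ∧ s ≤ C.card) ∨
      (k / 4 + 1 ≤ C.card ∧ σ + k / 4 ≤ 2 * C.card ∧ 2 * σ ≤ k + 1)) :
    ∃ b ∈ C, ∃ P ⊆ C, ∃ R ⊆ N (!ε) b, b ∉ P ∧ P.card = r ∧
      R.card = min (σ - 1) ((σ + k / 4) / 2) ∧ Disjoint R U ∧ Disjoint R P := by
  obtain ⟨P₀, hP₀, hP₀c⟩ := exists_subset_card_eq hrC
  have haQ : a ∈ U ∪ P₀ := mem_union_left _ ha
  have hQ := card_union_le U P₀
  have hCN : C ⊆ N ε a := hC ▸ sdiff_subset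
  obtain ⟨b, hb, hbt⟩ : ∃ b ∈ C, min (σ - 1) ((σ + k / 4) / 2) ≤ (N (!ε) b \ (U ∪ P₀)).card := by
    rcases hcase with ⟨h1, h2⟩ | ⟨h1, h2, h3⟩
    · rw [show min (σ - 1) ((σ + k / 4) / 2) = σ - 1 by omega]
      exact h.exists_le_card_sdiff_of_second_moment hd hk hC subset_union_left ha hσ (by omega) h1
        (by omega) (by omega)
    · exact h.exists_le_card_sdiff_of_first_moment hd hk hCN haQ hσ (by omega) h1 h2 h3
  obtain ⟨R, hR, hRc⟩ := exists_subset_card_eq hbt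
  obtain ⟨x, hx, hbx⟩ : ∃ x ∈ P₀, b ∉ P₀.erase x := by
    by_cases hbP : b ∈ P₀
    · exact ⟨b, hbP, notMem_erase _ _⟩
    · obtain ⟨x, hx⟩ : P₀.Nonempty := card_pos.1 (by omega)
      exact ⟨x, hx, fun hb' => hbP (mem_of_mem_erase hb')⟩
  refine ⟨b, hb, P₀.erase x, (erase_subset _ _).trans hP₀, R, hR.trans sdiff_subset, hbx, ?_, hRc,
    ?_, ?_⟩
  · rw [card_erase_of_mem hx]; omega
  · exact disjoint_of_subset_left hR (disjoint_sdiff_self_left.mono_right subset_union_left)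
  · exact disjoint_of_subset_left hR (disjoint_sdiff_self_left.mono_right
      ((erase_subset _ _).trans subset_union_right))

end IsHost

/-- For adjacent `p`, `y` in a tree, the vertices on the side of `y` of the edge `py`. -/
noncomputable def branch {W : Type*} [Fintype W] (G : SimpleGraph W) (p y : W) : Finset W :=
  open Classical in univ.filter fun w => (G.deleteEdges {s(p, y)}).Reachable y w

section Branch

variable {W : Type*} [Fintype W] {G : SimpleGraph W} {p y u v w : W}

theorem mem_branch : w ∈ branch G p y ↔ (G.deleteEdges {s(p, y)}).Reachable y w := by
  simp [branch]

theorem self_mem_branch : y ∈ branch G p y := mem_branch.2 .rfl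

theorem notMem_branch (hG : G.IsAcyclic) (h : G.Adj p y) : p ∉ branch G p y := fun hp =>
  (SimpleGraph.isBridge_iff.1 (SimpleGraph.isAcyclic_iff_forall_adj_isBridge.1 hG h))
    (mem_branch.1 hp).symm

theorem mem_branch_of_adj (hu : u ∈ branch G p y) (huv : G.Adj u v) (hup : u ≠ p) (hvp : v ≠ p) :
    v ∈ branch G p y := by
  refine mem_branch.2 ((mem_branch.1 hu).trans (SimpleGraph.Adj.reachable ?_))
  rw [SimpleGraph.deleteEdges_adj]
  refine ⟨huv, fun h => ?_⟩
  rcases Sym2.eq_iff.1 (Set.mem_singleton_iff.1 h) with ⟨h, -⟩ | ⟨-, h⟩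
  exacts [hup h, hvp h]

theorem eq_and_eq_of_mem_branch (hG : G.IsAcyclic) (h : G.Adj p y) (hu : u ∈ branch G p y)
    (hv : v ∉ branch G p y) (huv : G.Adj u v) : u = y ∧ v = p := by
  by_contra hne
  refine hv (mem_branch.2 ((mem_branch.1 hu).trans (SimpleGraph.Adj.reachable ?_)))
  rw [SimpleGraph.deleteEdges_adj]
  refine ⟨huv, fun h' => ?_⟩
  rcases Sym2.eq_iff.1 (Set.mem_singleton_iff.1 h') with ⟨h1, -⟩ | ⟨h1, h2⟩
  · exact notMem_branch hG h (h1 ▸ hu)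
  · exact hne ⟨h1, h2⟩

theorem branch_subset (hG : G.IsAcyclic) (h : G.Adj p y) {X : Set W} (hy : y ∈ X)
    (hX : ∀ u v, G.Adj u v → u ∈ X → v ≠ p → v ∈ X) (hw : w ∈ branch G p y) : w ∈ X := by
  have key : Relation.ReflTransGen (G.deleteEdges {s(p, y)}).Adj y w :=
    (SimpleGraph.reachable_iff_reflTransGen _ _).1 (mem_branch.1 hw)
  induction key with
  | refl => exact hy
  | @tail a c hac hadj ih =>
    have ha : a ∈ branch G p y := mem_branch.2 ((SimpleGraph.reachable_iff_reflTransGen _ _).2 hac)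
    refine hX a c (SimpleGraph.deleteEdges_le _ hadj) (ih ha) ?_
    rintro rfl
    exact notMem_branch hG h hw

theorem exists_mem_branch (hG : G.Connected) (hw : w ≠ p) : ∃ y, G.Adj p y ∧ w ∈ branch G p y := by
  have key := (SimpleGraph.reachable_iff_reflTransGen _ _).1 (hG.preconnected p w)
  induction key with
  | refl => exact absurd rfl hw
  | @tail a c _ hadj ih =>
    by_cases ha : a = p
    · exact ⟨c, ha ▸ hadj, self_mem_branch⟩
    · obtain ⟨y, hy, hay⟩ := ih ha
      exact ⟨y, hy, mem_branch_of_adj hay hadj ha hw⟩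

theorem disjoint_branch_branch (hG : G.IsAcyclic) (h : G.Adj p y) :
    Disjoint (branch G p y) (branch G y p) := by
  rw [disjoint_left]
  intro w h1 h2
  have h3 := mem_branch.1 h2
  rw [Sym2.eq_swap] at h3
  exact notMem_branch hG h (mem_branch.2 ((mem_branch.1 h1).trans h3.symm))

theorem exists_centroid (hG : G.IsTree) :
    ∃ z, ∀ y, G.Adj z y → 2 * (branch G z y).card ≤ Fintype.card W := by
  by_contra! hcon
  have : Nonempty W := hG.1.nonempty
  let z₀ : W := Classical.arbitrary W
  have hex : ∃ n, ∃ z y, G.Adj z y ∧ Fintype.card W < 2 * (branch G z y).card ∧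
      (branch G z y).card = n := by
    obtain ⟨y, hy, hc⟩ := hcon z₀
    exact ⟨_, z₀, y, hy, hc, rfl⟩
  classical
  obtain ⟨z, y, hzy, hbig, hn⟩ := Nat.find_spec hex
  obtain ⟨x, hyx, hbig'⟩ := hcon y
  by_cases hxz : x = z
  · subst hxz
    have h1 := card_le_univ (branch G x y ∪ branch G y x)
    rw [card_union_of_disjoint (disjoint_branch_branch hG.2 hzy)] at h1
    omega
  · have hsub : branch G y x ⊂ branch G z y := by
      refine (ssubset_iff_of_subset fun w hw => ?_).2
        ⟨y, self_mem_branch, notMem_branch hG.2 hyx⟩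
      refine (branch_subset (X := {w | w ∈ branch G z y ∧ w ≠ y}) hG.2 hyx
        ⟨mem_branch_of_adj self_mem_branch hyx hzy.ne' hxz, hyx.ne'⟩ ?_ hw).1
      intro u v huv hu hvy
      refine ⟨?_, hvy⟩
      by_contra hv
      exact hu.2 (eq_and_eq_of_mem_branch hG.2 hzy hu.1 hv huv).1
    exact Nat.find_min hex (hn ▸ card_lt_card hsub) ⟨y, x, hyx, hbig', rfl⟩

end Branch

/-- The vertices hanging below `q`. -/
def below {W : Type*} [Fintype W] [DecidableEq W] (α : W → W) (q : W) : Finset W :=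
  univ.filter fun w => α w = q ∧ w ≠ q

theorem mem_below {W : Type*} [Fintype W] [DecidableEq W] {α : W → W} {q w : W} :
    w ∈ below α q ↔ α w = q ∧ w ≠ q := by
  simp [below]

/-- Let the vertices of the branch at `y`, other than `y`, hang below `y`. -/
noncomputable def reanchor {W : Type*} [Fintype W] [DecidableEq W] (G : SimpleGraph W)
    (α : W → W) (p y w : W) : W := if w ∈ branch G p y then y else α w

/-- A partial embedding `f` of a tree: `w` is embedded when `α w = w`, any other vertex hangs
below the embedded vertex `α w`, and `A q` is a set of vertices of the host reserved for the
vertices hanging below `q`. -/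
structure IsPartialEmbedding {V W : Type*} [DecidableEq V] [Fintype W] [DecidableEq W]
    (G : SimpleGraph W) (sgn : W → Bool) (N : Bool → V → Finset V)
    (α : W → W) (f : W → V) (A : W → Finset V) : Prop where
  idem : ∀ w, α (α w) = α w
  edge : ∀ {u v}, G.Adj u v → α u = α v ∨ α u = u ∧ α v = v
  inj : ∀ {u v}, α u = u → α v = v → f u = f v → u = v
  adj : ∀ {u v}, α u = u → α v = v → G.Adj u v → f v ∈ N (sgn u) (f u)
  sub : ∀ q, α q = q → A q ⊆ N (sgn q) (f q)
  disj : ∀ {q q'}, q ≠ q' → Disjoint (A q) (A q')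
  avoid : ∀ {u}, α u = u → ∀ q, f u ∉ A q
  le : ∀ q, (A q).card ≤ (below α q).card
  act : ∀ {q}, α q = q → (N (sgn q) (f q)).Nonempty

namespace IsPartialEmbedding

variable {V W : Type*} [DecidableEq V] [Fintype W] [DecidableEq W]
  {G : SimpleGraph W} {sgn : W → Bool} {N : Bool → V → Finset V}
  {α : W → W} {f : W → V} {A : W → Finset V} {p y w : W}

/-- The vertices of the host that are used or reserved for the vertices hanging below another
vertex than `p`. -/
def blocked (α : W → W) (f : W → V) (A : W → Finset V) (p : W) : Finset V :=
  (univ.filter fun w => α w = w).image f ∪ (univ.erase p).biUnion A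

theorem mem_blocked {x : V} :
    x ∈ blocked α f A p ↔ (∃ w, α w = w ∧ f w = x) ∨ ∃ q, q ≠ p ∧ x ∈ A q := by
  simp [blocked]

theorem card_blocked_add_le (h : IsPartialEmbedding G sgn N α f A) (p : W) :
    (blocked α f A p).card + (below α p).card ≤ Fintype.card W := by
  have h1 : (blocked α f A p).card ≤ (univ.filter fun w => α w = w).card +
      ∑ q ∈ univ.erase p, (below α q).card :=
    (card_union_le _ _).trans (add_le_add card_image_le
      (card_biUnion_le.trans (sum_le_sum fun q _ => h.le q)))
  have h2 := add_sum_erase univ (fun q => (below α q).card) (mem_univ p)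
  have h3 : (univ.filter fun w => ¬ α w = w).card
      = ∑ q, (below α q).card := by
    rw [card_eq_sum_card_fiberwise (f := α) (t := univ) (fun _ _ => by simp)]
    refine sum_congr rfl fun q _ => ?_
    rw [filter_filter, below]
    congr 1
    ext w
    simp only [mem_filter, mem_univ, true_and]
    constructor
    · rintro ⟨h1, rfl⟩; exact ⟨rfl, Ne.symm h1⟩
    · rintro ⟨rfl, h1⟩; exact ⟨Ne.symm h1, rfl⟩
  have h4 := card_filter_add_card_filter_not (s := (univ : Finset W)) (fun w => α w = w)
  rw [card_univ] at h4
  omega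

theorem branch_hangs (h : IsPartialEmbedding G sgn N α f A) (hG : G.IsAcyclic) (hpy : G.Adj p y)
    (hy : α y = p) (hw : w ∈ branch G p y) : α w = p ∧ w ≠ p := by
  refine branch_subset (X := {w | α w = p ∧ w ≠ p}) hG hpy ⟨hy, hpy.ne'⟩ ?_ hw
  intro u v huv hu hv
  refine ⟨?_, hv⟩
  rcases h.edge huv with h1 | ⟨h1, -⟩
  · exact h1 ▸ hu.1
  · exact absurd (h1.symm.trans hu.1) hu.2

theorem hangs_of_mem_branch (h : IsPartialEmbedding G sgn N α f A) (hG : G.IsAcyclic)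
    (hpy : G.Adj p y) (hw : w ∈ branch G p y) (hwp : α w = p) : α y = p := by
  by_contra hy
  refine branch_subset (X := {w | α w ≠ p}) hG hpy hy ?_ hw hwp
  intro u v huv hu hv
  rcases h.edge huv with h1 | ⟨-, h1⟩
  · exact fun h2 => hu (h1.trans h2)
  · exact fun h2 => hv (h1.symm.trans h2)

theorem hangs_of_adj (h : IsPartialEmbedding G sgn N α f A) (hp : α p = p) (hpy : G.Adj p y)
    (hy : α y ≠ y) : α y = p := by
  rcases h.edge hpy with h1 | ⟨-, h1⟩
  · exact h1 ▸ hp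
  · exact absurd h1 hy

theorem reanchor_eq_self_iff (h : IsPartialEmbedding G sgn N α f A) (hG : G.IsAcyclic)
    (hpy : G.Adj p y) (hy : α y = p) : reanchor G α p y w = w ↔ α w = w ∨ w = y := by
  unfold reanchor
  split_ifs with hw
  · have := h.branch_hangs hG hpy hy hw
    constructor
    · exact fun h => .inr h.symm
    · rintro (h1 | h1)
      · exact absurd (h1.symm.trans this.1) this.2
      · exact h1.symm
  · constructor
    · exact fun h => .inl h
    · rintro (h1 | rfl)
      · exact h1
      · exact absurd self_mem_branch hw

theorem below_reanchor_parent (h : IsPartialEmbedding G sgn N α f A) (hG : G.IsAcyclic)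
    (hpy : G.Adj p y) (hy : α y = p) :
    (below (reanchor G α p y) p).card + (branch G p y).card = (below α p).card := by
  have hsub : branch G p y ⊆ below α p := fun w hw => by
    simpa [mem_below] using h.branch_hangs hG hpy hy hw
  rw [← card_sdiff_add_card_eq_card hsub]
  congr 2
  ext w
  by_cases hw : w ∈ branch G p y <;> simp [mem_below, reanchor, hw, hpy.ne']

theorem below_reanchor_child (h : IsPartialEmbedding G sgn N α f A) (hpy : G.Adj p y)
    (hy : α y = p) : (below (reanchor G α p y) y).card = (branch G p y).card - 1 := by
  rw [← card_erase_of_mem self_mem_branch]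
  congr 1
  ext w
  by_cases hw : w ∈ branch G p y
  · simp [mem_below, reanchor, hw]
  · have : α w ≠ y := by
      rintro rfl
      exact hpy.ne' ((h.idem w).symm.trans hy)
    simp [mem_below, reanchor, hw, this]

theorem below_reanchor_of_ne (h : IsPartialEmbedding G sgn N α f A) (hG : G.IsAcyclic)
    (hpy : G.Adj p y) (hy : α y = p) {q : W} (hqp : q ≠ p) (hqy : q ≠ y) :
    below (reanchor G α p y) q = below α q := by
  ext w
  by_cases hw : w ∈ branch G p y
  · simp [mem_below, reanchor, hw, (h.branch_hangs hG hpy hy hw).1, hqp.symm, hqy.symm]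
  · simp [mem_below, reanchor, hw]

theorem extend {k d : ℕ} (h : IsPartialEmbedding G sgn N α f A) (hN : IsHost N k d)
    (hG : G.IsAcyclic)
    (hsgn : ∀ {u v}, G.Adj u v → sgn v = !sgn u) (hp : α p = p) (hpy : G.Adj p y) (hy : α y = p)
    {b : V} {P R : Finset V} (hb : b ∈ N (sgn p) (f p) \ blocked α f A p)
    (hP : P ⊆ N (sgn p) (f p) \ blocked α f A p) (hR : R ⊆ N (sgn y) b) (hbP : b ∉ P)
    (hPc : P.card + (branch G p y).card ≤ (below α p).card)
    (hRc : R.card ≤ (branch G p y).card - 1) (hRU : Disjoint R (blocked α f A p))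
    (hRP : Disjoint R P) :
    IsPartialEmbedding G sgn N (reanchor G α p y)
      (Function.update f y b) (Function.update (Function.update A p P) y R) := by
  have hyy : α y ≠ y := fun h1 => hpy.ne (hy.symm.trans h1)
  have hfix := fun w => h.reanchor_eq_self_iff (w := w) hG hpy hy
  rw [mem_sdiff, mem_blocked] at hb
  push Not at hb
  obtain ⟨hbN, hbf, hbA⟩ := hb
  have hfp : f p ∈ N (sgn y) b := by rw [hsgn hpy]; exact hN.symm hbN
  have hPN : P ⊆ N (sgn p) (f p) := hP.trans sdiff_subset
  have hPU : Disjoint P (blocked α f A p) := disjoint_of_subset_left hP disjoint_sdiff_self_left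
  have hf : ∀ {u}, α u = u → Function.update f y b u = f u := fun hu =>
    Function.update_of_ne (by rintro rfl; exact hyy hu) _ _
  have hblock : ∀ q, q ≠ p → A q ⊆ blocked α f A p := fun q hq x hx =>
    mem_blocked.2 (.inr ⟨q, hq, hx⟩)
  have hPA : ∀ q, q ≠ p → Disjoint P (A q) := fun q hq => hPU.mono_right (hblock q hq)
  have hRA : ∀ q, q ≠ p → Disjoint R (A q) := fun q hq => hRU.mono_right (hblock q hq)
  constructor
  · intro w
    rw [hfix]
    unfold reanchor
    split_ifs
    exacts [.inr rfl, .inl (h.idem w)]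
  · have hmixed : ∀ {u v}, G.Adj u v → u ∈ branch G p y → v ∉ branch G p y →
        reanchor G α p y u = u ∧ reanchor G α p y v = v := fun huv hu hv => by
      obtain ⟨rfl, rfl⟩ := eq_and_eq_of_mem_branch hG hpy hu hv huv
      exact ⟨(hfix _).2 (.inr rfl), (hfix _).2 (.inl hp)⟩
    intro u v huv
    by_cases hu : u ∈ branch G p y <;> by_cases hv : v ∈ branch G p y
    · simp [reanchor, hu, hv]
    · exact .inr (hmixed huv hu hv)
    · exact .inr (hmixed huv.symm hv hu).symm
    · simpa [reanchor, hu, hv] using h.edge huv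
  · intro u v hu hv huv
    rcases (hfix u).1 hu with hu' | hu' <;> rcases (hfix v).1 hv with hv' | hv'
    · rw [hf hu', hf hv'] at huv
      exact h.inj hu' hv' huv
    · rw [hf hu', hv', Function.update_self] at huv
      exact absurd huv (hbf u hu')
    · rw [hf hv', hu', Function.update_self] at huv
      exact absurd huv.symm (hbf v hv')
    · exact hu'.trans hv'.symm
  · have hnbr : ∀ {v}, α v = v → G.Adj y v → v = p := fun {v} hv hyv => by
      refine (eq_and_eq_of_mem_branch hG hpy self_mem_branch (fun hvB => ?_) hyv).2
      have := h.branch_hangs hG hpy hy hvB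
      exact this.2 (hv.symm.trans this.1)
    intro u v hu hv huv
    rcases (hfix u).1 hu with hu' | hu' <;> rcases (hfix v).1 hv with hv' | hv'
    · rw [hf hu', hf hv']
      exact h.adj hu' hv' huv
    · subst hv'
      obtain rfl := hnbr hu' huv.symm
      rw [hf hu', Function.update_self]
      exact hbN
    · subst hu'
      obtain rfl := hnbr hv' huv
      rw [hf hv', Function.update_self]
      exact hfp
    · exact absurd (hu'.trans hv'.symm) huv.ne
  · intro q hq
    by_cases hqy : q = y
    · subst hqy; simpa using hR
    · have hq := ((hfix q).1 hq).resolve_right hqy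
      rw [hf hq, Function.update_of_ne hqy]
      by_cases hqp : q = p
      · subst hqp; simpa using hPN
      · rw [Function.update_of_ne hqp]; exact h.sub q hq
  · intro q q' hqq
    simp only [Function.update_apply]
    split_ifs with h1 h2 h3 h4 h5 h6 h7
    · exact absurd (h1.trans h2.symm) hqq
    · exact hRP
    · exact hRA _ h3
    · exact hRP.symm
    · exact absurd (h4.trans h6.symm) hqq
    · exact hPA _ h6
    · exact (hRA _ h4).symm
    · exact (hPA _ h4).symm
    · exact h.disj hqq
  · intro u hu q
    simp only [Function.update_apply]
    have hfb : ∀ w, α w = w → f w ∈ blocked α f A p := fun w hw =>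
      mem_blocked.2 (.inl ⟨w, hw, rfl⟩)
    by_cases huy : u = y
    · rw [if_pos huy]
      split_ifs with h1 h2
      · exact fun h3 => hN.irrefl _ _ (hR h3)
      · exact hbP
      · exact hbA q h2
    · have hu := ((hfix u).1 hu).resolve_right huy
      rw [if_neg huy]
      split_ifs with h1 h2
      · exact fun h3 => disjoint_left.1 hRU h3 (hfb u hu)
      · exact fun h3 => disjoint_left.1 hPU h3 (hfb u hu)
      · exact h.avoid hu q
  · intro q
    by_cases hqy : q = y
    · subst hqy
      rw [h.below_reanchor_child hpy hy]; simpa using hRc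
    · rw [Function.update_of_ne hqy]
      by_cases hqp : q = p
      · subst hqp
        have := h.below_reanchor_parent hG hpy hy
        rw [Function.update_self]; omega
      · rw [Function.update_of_ne hqp, h.below_reanchor_of_ne hG hpy hy hqp hqy]
        exact h.le q
  · intro q hq
    rcases (hfix q).1 hq with hq | rfl
    · rw [hf hq]; exact h.act hq
    · rw [Function.update_self]; exact ⟨_, hfp⟩

end IsPartialEmbedding

/-- The reserved sets of a partial embedding are large enough for it to be extended vertex by
vertex, where `z` is a centroid of the tree and `j` of its neighbours are embedded. -/
structure IsRoomy {V W : Type*} [Fintype W] [DecidableEq W]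
    (G : SimpleGraph W) [DecidableRel G.Adj] (k : ℕ) (z : W)
    (α : W → W) (A : W → Finset V) (j : ℕ) : Prop where
  fixed : α z = z
  room : ∀ q, α q = q → q ≠ z →
    min (below α q).card (((below α q).card + k / 4 + 1) / 2) ≤ (A q).card ∧
      2 * (below α q).card + 1 ≤ k
  room_root : min (below α z).card ((k + 1) / 2 - j) ≤ (A z).card
  count : j + (univ.filter fun y => G.Adj z y ∧ α y ≠ y).card ≤ k / 4
  root : (∀ y, G.Adj z y → α y ≠ y → (branch G z y).card ≤ k / 4 + 1) ∨
    (below α z).card + j * (k / 4 + 2) ≤ k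

section Extension

variable {V W : Type*} [DecidableEq V] [Fintype W] [DecidableEq W]
  {G : SimpleGraph W} [DecidableRel G.Adj] {sgn : W → Bool} {N : Bool → V → Finset V}
  {α : W → W} {f : W → V} {A : W → Finset V} {p y z w : W} {k d j : ℕ}

theorem IsRoomy.extend (h : IsPartialEmbedding G sgn N α f A) (hr : IsRoomy G k z α A j)
    (hG : G.IsAcyclic) (hpy : G.Adj p y) (hy : α y = p) {j' : ℕ} {P R : Finset V}
    (hσk : 2 * ((branch G p y).card - 1) + 1 ≤ k)
    (hR : min ((branch G p y).card - 1) (((branch G p y).card - 1 + k / 4 + 1) / 2) ≤ R.card)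
    (hnext : (p ≠ z ∧ j' = j ∧ min ((below α p).card - (branch G p y).card)
        (((below α p).card - (branch G p y).card + k / 4 + 1) / 2) ≤ P.card) ∨
      (p = z ∧ j' = j + 1 ∧
        min ((below α p).card - (branch G p y).card) ((k + 1) / 2 - j') ≤ P.card ∧
        ((∀ y, G.Adj z y → α y ≠ y → (branch G z y).card ≤ k / 4 + 1) ∨
          (below α z).card + j' * (k / 4 + 2) ≤ k + (branch G p y).card))) :
    IsRoomy G k z (reanchor G α p y) (Function.update (Function.update A p P) y R) j' := by
  have hyy : α y ≠ y := fun h1 => hpy.ne (hy.symm.trans h1)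
  have hyz : y ≠ z := by rintro rfl; exact hyy hr.fixed
  have hfix := fun w => h.reanchor_eq_self_iff (w := w) hG hpy hy
  have hparent := Nat.eq_sub_of_add_eq (h.below_reanchor_parent hG hpy hy)
  have hsub : (univ.filter fun w => G.Adj z w ∧ reanchor G α p y w ≠ w) =
      (univ.filter fun w => G.Adj z w ∧ α w ≠ w).erase y := by
    ext w
    simp [hfix]
    tauto
  constructor
  · exact (hfix z).2 (.inl hr.fixed)
  · intro q hq hqz
    by_cases hqy : q = y
    · subst hqy
      rw [h.below_reanchor_child hpy hy, Function.update_self]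
      exact ⟨hR, hσk⟩
    · rw [Function.update_of_ne hqy]
      have hq' := ((hfix q).1 hq).resolve_right hqy
      by_cases hqp : q = p
      · subst hqp
        have h1 := (hr.room q hq' hqz).2
        have h2 := (hnext.resolve_right fun h3 => hqz h3.1).2.2
        rw [Function.update_self, hparent]
        exact ⟨h2, by omega⟩
      · rw [Function.update_of_ne hqp, h.below_reanchor_of_ne hG hpy hy hqp hqy]
        exact hr.room q hq' hqz
  · rw [Function.update_of_ne hyz.symm]
    rcases hnext with ⟨h1, rfl, -⟩ | ⟨rfl, h1, h2, -⟩
    · rw [Function.update_of_ne h1.symm, h.below_reanchor_of_ne hG hpy hy h1.symm hyz.symm]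
      exact hr.room_root
    · rw [Function.update_self, hparent]
      exact h2
  · have hcount := hr.count
    rw [hsub]
    rcases hnext with ⟨h1, rfl, -⟩ | ⟨rfl, rfl, -⟩
    · exact (Nat.add_le_add_left card_erase_le _).trans hcount
    · have hmem : y ∈ univ.filter fun w => G.Adj p w ∧ α w ≠ w := by simp [hpy, hyy]
      have := card_pos.2 ⟨y, hmem⟩
      rw [card_erase_of_mem hmem]
      omega
  · have hmono : (∀ y, G.Adj z y → α y ≠ y → (branch G z y).card ≤ k / 4 + 1) →
        ∀ x, G.Adj z x → reanchor G α p y x ≠ x → (branch G z x).card ≤ k / 4 + 1 :=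
      fun h1 x hx hx' => h1 x hx fun h2 => hx' ((hfix x).2 (.inl h2))
    rcases hnext with ⟨h1, rfl, -⟩ | ⟨rfl, h1, h2, h3⟩
    · rw [h.below_reanchor_of_ne hG hpy hy h1.symm hyz.symm]
      exact hr.root.imp_left hmono
    · have := h.below_reanchor_parent hG hpy hy
      exact h3.imp hmono fun h4 => by omega

theorem exists_partial_extension (h : IsPartialEmbedding G sgn N α f A) (hr : IsRoomy G k z α A j)
    (hN : IsHost N k d) (hd : 12 * d + 1 ≤ k) (hk : 13 ≤ k) (hG : G.IsAcyclic)
    (hcard : Fintype.card W = k + 1) (hsgn : ∀ {u v}, G.Adj u v → sgn v = !sgn u)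
    (hp : α p = p) (hpy : G.Adj p y) (hy : α y = p) {r j' : ℕ}
    (hσk : 2 * (branch G p y).card ≤ k + 1)
    (hrs : r + (branch G p y).card ≤ (below α p).card) (hrA : r + 1 ≤ (A p).card)
    (hcase : (4 * (branch G p y).card ≤ k ∧ (below α p).card ≤ (A p).card) ∨
      (k / 4 + 1 ≤ (A p).card ∧ (branch G p y).card + k / 4 ≤ 2 * (A p).card))
    (hnext : (p ≠ z ∧ j' = j ∧ min ((below α p).card - (branch G p y).card)
        (((below α p).card - (branch G p y).card + k / 4 + 1) / 2) ≤ r) ∨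
      (p = z ∧ j' = j + 1 ∧ min ((below α p).card - (branch G p y).card) ((k + 1) / 2 - j') ≤ r ∧
        ((∀ y, G.Adj z y → α y ≠ y → (branch G z y).card ≤ k / 4 + 1) ∨
          (below α z).card + j' * (k / 4 + 2) ≤ k + (branch G p y).card))) :
    ∃ α' f' A', IsPartialEmbedding G sgn N α' f' A' ∧ IsRoomy G k z α' A' j' ∧
      (univ.filter fun w => α' w ≠ w).card < (univ.filter fun w => α w ≠ w).card := by
  have hAC : (A p).card ≤ (N (sgn p) (f p) \ IsPartialEmbedding.blocked α f A p).card := by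
    refine card_le_card fun x hx => mem_sdiff.2 ⟨h.sub p hp hx, fun hx' => ?_⟩
    rcases IsPartialEmbedding.mem_blocked.1 hx' with ⟨w, hw, rfl⟩ | ⟨q, hq, hxq⟩
    · exact h.avoid hw p hx
    · exact disjoint_left.1 (h.disj hq) hxq hx
  have hσ : 1 ≤ (branch G p y).card := card_pos.2 ⟨y, self_mem_branch⟩
  obtain ⟨b, hb, P, hP, R, hR, hbP, rfl, hRc, hRU, hRP⟩ := hN.exists_extension
    (ε := sgn p) (a := f p) (U := IsPartialEmbedding.blocked α f A p)
    (σ := (branch G p y).card) (s := (below α p).card) (r := r) hd hk rfl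
    (IsPartialEmbedding.mem_blocked.2 (.inl ⟨p, hp, rfl⟩)) hσ
    (hcard ▸ h.card_blocked_add_le p) hrs (hrA.trans hAC)
    (hcase.imp (fun h1 => ⟨h1.1, h1.2.trans hAC⟩) (fun h1 => ⟨h1.1.trans hAC, by omega, hσk⟩))
  rw [← hsgn hpy] at hR
  have hyy : α y ≠ y := fun h1 => hpy.ne (hy.symm.trans h1)
  refine ⟨_, _, _, h.extend hN hG hsgn hp hpy hy hb hP hR hbP hrs
    (hRc.trans_le (min_le_left _ _)) hRU hRP,
    hr.extend h hG hpy hy (by omega) (by omega) hnext, ?_⟩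
  refine card_lt_card ((ssubset_iff_of_subset fun w hw => ?_).2 ⟨y, by simp [hyy], ?_⟩)
  · simp only [mem_filter, mem_univ, true_and, ne_eq, h.reanchor_eq_self_iff hG hpy hy] at hw ⊢
    exact fun h1 => hw (.inl h1)
  · simp [h.reanchor_eq_self_iff hG hpy hy]

theorem exists_two_le_card_branch (h : IsPartialEmbedding G sgn N α f A) (hG : G.IsTree)
    (hdeg : ∀ w, (univ.filter fun y => G.Adj w y).card ≤ k / 4) (hs : k / 4 < (below α p).card) :
    ∃ y, G.Adj p y ∧ α y = p ∧ 2 ≤ (branch G p y).card := by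
  by_contra! hcon
  refine (hs.trans_le ((card_le_card fun w hw => ?_).trans (hdeg p))).false
  obtain ⟨hw1, hw2⟩ := mem_below.1 hw
  obtain ⟨y, hpy, hwy⟩ := exists_mem_branch hG.1 hw2
  have := hcon y hpy (h.hangs_of_mem_branch hG.2 hpy hwy hw1)
  rw [card_le_one.1 (Nat.lt_succ_iff.1 this) w hwy y self_mem_branch]
  simpa using hpy

theorem exists_step (h : IsPartialEmbedding G sgn N α f A) (hr : IsRoomy G k z α A j)
    (hN : IsHost N k d) (hd : 12 * d + 1 ≤ k) (hk : 13 ≤ k) (hG : G.IsTree)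
    (hcard : Fintype.card W = k + 1) (hsgn : ∀ {u v}, G.Adj u v → sgn v = !sgn u)
    (hdeg : ∀ w, (univ.filter fun y => G.Adj w y).card ≤ k / 4)
    (hz : ∀ y, G.Adj z y → 2 * (branch G z y).card ≤ k + 1) (hw : α w ≠ w) :
    ∃ α' f' A' j', IsPartialEmbedding G sgn N α' f' A' ∧ IsRoomy G k z α' A' j' ∧
      (univ.filter fun w => α' w ≠ w).card < (univ.filter fun w => α w ≠ w).card := by
  obtain ⟨p, hwp⟩ : ∃ p, α w = p := ⟨_, rfl⟩
  have hp : α p = p := hwp ▸ h.idem w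
  obtain ⟨y₀, hpy₀, hwy₀⟩ := exists_mem_branch hG.1 (hwp ▸ hw.symm : w ≠ p)
  have hy₀ := h.hangs_of_mem_branch hG.2 hpy₀ hwy₀ hwp
  have hle : ∀ {y}, G.Adj p y → α y = p → (branch G p y).card ≤ (below α p).card :=
    fun hpy hy => card_le_card fun w hw => mem_below.2 (h.branch_hangs hG.2 hpy hy hw)
  have hpos : ∀ y, 1 ≤ (branch G p y).card := fun y => card_pos.2 ⟨y, self_mem_branch⟩
  by_cases hpz : p = z
  · subst hpz
    have hcount := hr.count
    have hroom := hr.room_root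
    have hjpos : ∀ {y}, G.Adj p y → α y = p →
        1 ≤ (univ.filter fun y => G.Adj p y ∧ α y ≠ y).card := fun {y} hpy hy =>
      card_pos.2 ⟨y, by simp [hpy, hy, hpy.ne]⟩
    have hhang : ∀ {y}, G.Adj p y → α y ≠ y → α y = p := fun hpy hy => h.hangs_of_adj hp hpy hy
    have hj := hjpos hpy₀ hy₀
    suffices ∃ y, G.Adj p y ∧ α y = p ∧
        ((4 * (branch G p y).card ≤ k ∧ (below α p).card ≤ (A p).card) ∨
          (k / 4 + 1 ≤ (A p).card ∧ (branch G p y).card + k / 4 ≤ 2 * (A p).card)) ∧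
        ((∀ y, G.Adj p y → α y ≠ y → (branch G p y).card ≤ k / 4 + 1) ∨
          (below α p).card + (j + 1) * (k / 4 + 2) ≤ k + (branch G p y).card) by
      obtain ⟨y, hpy, hy, hcase, halt⟩ := this
      have h1 := hle hpy hy
      have h2 := hpos y
      obtain ⟨α', f', A', h'⟩ := exists_partial_extension h hr hN hd hk hG.2 hcard hsgn hp hpy hy
        (r := min ((below α p).card - (branch G p y).card) ((k + 1) / 2 - (j + 1)))
        (hz y hpy) (by omega) (by omega) hcase (.inr ⟨rfl, rfl, le_rfl, halt⟩)
      exact ⟨α', f', A', j + 1, h'⟩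
    by_cases hbig : ∃ y, G.Adj p y ∧ α y ≠ y ∧ k / 4 + 2 ≤ (branch G p y).card
    · obtain ⟨y, hpy, hy, hyb⟩ := hbig
      have hroot := hr.root.resolve_left fun h1 => by
        have := h1 y hpy hy
        omega
      have h1 := hle hpy (hhang hpy hy)
      have h2 := hz y hpy
      have h3 : j ≤ 2 := by
        by_contra! h3
        have := Nat.mul_le_mul_right (k / 4 + 2) (show 3 ≤ j from h3)
        omega
      refine ⟨y, hpy, hhang hpy hy, .inr ?_, .inr (by rw [add_mul]; omega)⟩
      interval_cases j <;> omega
    · push Not at hbig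
      have hsmall : ∀ y, G.Adj p y → α y ≠ y → (branch G p y).card ≤ k / 4 + 1 :=
        fun y h1 h2 => Nat.lt_succ_iff.1 (hbig y h1 h2)
      by_cases hs : (below α p).card ≤ k / 4
      · have := hle hpy₀ hy₀
        exact ⟨y₀, hpy₀, hy₀, .inl (by omega), .inl hsmall⟩
      · have := hsmall y₀ hpy₀ (hy₀ ▸ hpy₀.ne)
        exact ⟨y₀, hpy₀, hy₀, .inr (by omega), .inl hsmall⟩
  · have hroom := hr.room p hp hpz
    suffices ∃ y, G.Adj p y ∧ α y = p ∧
        ((below α p).card ≤ k / 4 ∨ 2 ≤ (branch G p y).card) by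
      obtain ⟨y, hpy, hy, hcase⟩ := this
      have h1 := hle hpy hy
      have h2 := hpos y
      obtain ⟨α', f', A', h'⟩ := exists_partial_extension h hr hN hd hk hG.2 hcard hsgn hp hpy hy
        (r := min ((below α p).card - (branch G p y).card)
          (((below α p).card - (branch G p y).card + k / 4 + 1) / 2))
        (by omega) (by omega) (by omega) (by omega) (.inl ⟨hpz, rfl, le_rfl⟩)
      exact ⟨α', f', A', j, h'⟩
    by_cases hs : (below α p).card ≤ k / 4
    · exact ⟨y₀, hpy₀, hy₀, .inl hs⟩
    · obtain ⟨y, hpy, hy, hyb⟩ := exists_two_le_card_branch h hG hdeg (not_le.1 hs)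
      exact ⟨y, hpy, hy, .inr hyb⟩

theorem exists_completion (hN : IsHost N k d) (hd : 12 * d + 1 ≤ k) (hk : 13 ≤ k) (hG : G.IsTree)
    (hcard : Fintype.card W = k + 1) (hsgn : ∀ {u v}, G.Adj u v → sgn v = !sgn u)
    (hdeg : ∀ w, (univ.filter fun y => G.Adj w y).card ≤ k / 4)
    (hz : ∀ y, G.Adj z y → 2 * (branch G z y).card ≤ k + 1)
    (h : IsPartialEmbedding G sgn N α f A) (hr : IsRoomy G k z α A j) :
    ∃ f : W → V, Function.Injective f ∧ ∀ u v, G.Adj u v → f v ∈ N (sgn u) (f u) := by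
  induction hn : (univ.filter fun w => α w ≠ w).card using Nat.strong_induction_on
    generalizing α f A j with
  | _ n ih =>
    by_cases hall : ∀ w, α w = w
    · exact ⟨f, fun u v huv => h.inj (hall u) (hall v) huv,
        fun u v huv => h.adj (hall u) (hall v) huv⟩
    · push Not at hall
      obtain ⟨w, hw⟩ := hall
      obtain ⟨α', f', A', j', h', hr', hlt⟩ :=
        exists_step h hr hN hd hk hG hcard hsgn hdeg hz hw
      exact ih _ (hn ▸ hlt) h' hr' rfl

theorem IsHost.exists_embedding (hN : IsHost N k d) (hd : 12 * d + 1 ≤ k) (hk : 13 ≤ k)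
    (hne : ∀ ε, ∃ a, (N ε a).Nonempty) (hG : G.IsTree)
    (hcard : Fintype.card W = k + 1) (hsgn : ∀ {u v}, G.Adj u v → sgn v = !sgn u)
    (hdeg : ∀ w, (univ.filter fun y => G.Adj w y).card ≤ k / 4) :
    ∃ f : W → V, Function.Injective f ∧ ∀ u v, G.Adj u v → f v ∈ N (sgn u) (f u) := by
  obtain ⟨z, hz⟩ := exists_centroid hG
  rw [hcard] at hz
  obtain ⟨a, ha⟩ := hne (sgn z)
  have hka := hN.deg ha
  obtain ⟨S, hS, hSc⟩ := exists_subset_card_eq (show (k + 1) / 2 ≤ (N (sgn z) a).card by omega)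
  have hbelow : ∀ q, (below (fun _ => z) q).card = if q = z then k else 0 := by
    intro q
    split_ifs with hq
    · subst hq
      have : below (fun _ => q) q = univ.erase q := by ext; simp [mem_below]
      rw [this, card_erase_of_mem (mem_univ q), card_univ, hcard]; rfl
    · rw [card_eq_zero, eq_empty_iff_forall_notMem]
      exact fun w hw => hq (mem_below.1 hw).1.symm
  refine exists_completion (z := z) (α := fun _ => z) (f := fun _ => a)
    (A := fun q => if q = z then S else ∅) (j := 0) hN hd hk hG hcard hsgn hdeg hz ?_ ?_
  · constructor
    · exact fun _ => rfl
    · exact fun _ => .inl rfl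
    · exact fun hu hv _ => hu.symm.trans hv
    · exact fun hu hv huv => absurd (hu.symm.trans hv) huv.ne
    · intro q hq
      simpa [← hq] using hS
    · intro q q' hqq
      split_ifs with h1 h2
      · exact absurd (h1.trans h2.symm) hqq
      all_goals simp
    · intro u _ q
      split_ifs
      · exact fun h1 => hN.irrefl _ _ (hS h1)
      · simp
    · intro q
      rw [hbelow]
      split_ifs
      · omega
      · simp
    · intro q hq
      simpa [← hq] using ha
  · constructor
    · rfl
    · exact fun q hq hqz => absurd hq.symm hqz
    · simp [hSc]
    · rw [zero_add]
      exact (card_le_card fun y hy => by simp at hy ⊢; exact hy.1).trans (hdeg z)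
    · exact .inr (by simp [hbelow])

end Extension

theorem mem_nbr_of_loopless {V : Type*} [Fintype V] {D : V → V → Bool} (hloop : Loopless D)
    (ε : Bool) (a : V) : a ∉ nbr D ε a := by
  cases ε <;> simpa [nbr, outNbr, inNbr] using hloop a

theorem K2sFree.card_inter_le {V : Type*} [Fintype V] [DecidableEq V] {D : V → V → Bool} {s : ℕ}
    (hfree : K2sFree D s) (hloop : Loopless D) (ε ε' : Bool) {a b : V} (hab : a ≠ b) :
    (nbr D ε a ∩ nbr D ε' b).card ≤ s - 1 := by
  by_contra! hcon
  obtain ⟨S, hS, hSc⟩ := exists_subset_card_eq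
    (show s ≤ (nbr D ε a ∩ nbr D ε' b).card by omega)
  exact hfree ⟨a, b, ε, ε', S, hab, hSc,
    fun h => mem_nbr_of_loopless hloop _ _ (mem_inter.1 (hS h)).1,
    fun h => mem_nbr_of_loopless hloop _ _ (mem_inter.1 (hS h)).2, hS⟩

theorem exists_dense_pair {V : Type*} [Fintype V] [DecidableEq V] {D : V → V → Bool} {k : ℕ}
    (harcs : (k - 1) * Fintype.card V < arcCount D) :
    ∃ X Y : Finset V, (∃ a ∈ X, ∃ b ∈ Y, D a b) ∧
      (∀ a ∈ X, k ≤ 2 * (Y.filter fun b => D a b).card) ∧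
      ∀ b ∈ Y, k ≤ 2 * (X.filter fun a => D a b).card := by
  let e : Finset V → Finset V → ℕ := fun X Y => ∑ a ∈ X, ∑ b ∈ Y, if D a b then 1 else 0
  have hstart : (k - 1) * ((univ : Finset V).card + (univ : Finset V).card) < 2 * e univ univ := by
    have : arcCount D = e univ univ := by
      rw [arcCount, card_filter, Fintype.sum_prod_type]
    rw [card_univ, ← this]
    linarith
  obtain ⟨⟨X, Y⟩, hXY, hmin⟩ := exists_min_image
    (univ.filter fun p : Finset V × Finset V => (k - 1) * (p.1.card + p.2.card) < 2 * e p.1 p.2)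
    (fun p => p.1.card + p.2.card) ⟨(univ, univ), by simpa using hstart⟩
  simp only [mem_filter, mem_univ, true_and, Prod.forall] at hXY hmin
  refine ⟨X, Y, ?_, fun a ha => ?_, fun b hb => ?_⟩
  · have hpos : e X Y ≠ 0 := by omega
    obtain ⟨a, ha, h1⟩ := exists_ne_zero_of_sum_ne_zero hpos
    obtain ⟨b, hb, h2⟩ := exists_ne_zero_of_sum_ne_zero h1
    exact ⟨a, ha, b, hb, by simpa using h2⟩
  · have h1 : (Y.filter fun b => D a b).card + e (X.erase a) Y = e X Y := by
      rw [card_filter]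
      exact add_sum_erase X (fun a => ∑ b ∈ Y, if D a b then 1 else 0) ha
    have h2 := mt (hmin (X.erase a) Y)
    have h3 := card_erase_add_one ha
    rw [← h3, ← h1] at hXY
    have h4 : (k - 1) * ((X.erase a).card + 1 + Y.card) =
      (k - 1) * ((X.erase a).card + Y.card) + (k - 1) := by ring
    omega
  · have h1 : (X.filter fun a => D a b).card + e X (Y.erase b) = e X Y := by
      simp only [e]
      rw [card_filter, sum_comm, sum_comm (s := X) (t := Y)]
      exact add_sum_erase Y (fun b => ∑ a ∈ X, if D a b then 1 else 0) hb
    have h2 := mt (hmin X (Y.erase b))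
    have h3 := card_erase_add_one hb
    rw [← h3, ← h1] at hXY
    have h4 : (k - 1) * (X.card + ((Y.erase b).card + 1)) =
      (k - 1) * (X.card + (Y.erase b).card) + (k - 1) := by ring
    omega

theorem exists_isHost {V : Type*} [Fintype V] [DecidableEq V] {D : V → V → Bool} {k s : ℕ}
    (hloop : Loopless D) (hfree : K2sFree D s) (harcs : (k - 1) * Fintype.card V < arcCount D) :
    ∃ N, IsHost N k (s - 1) ∧ (∀ ε, ∃ a, (N ε a).Nonempty) ∧ ∀ ε a, N ε a ⊆ nbr D ε a := by
  obtain ⟨X, Y, ⟨a₀, ha₀, b₀, hb₀, hab₀⟩, hX, hY⟩ := exists_dense_pair harcs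
  let N : Bool → V → Finset V := fun ε a =>
    if ε then (if a ∈ X then Y.filter fun b => D a b else ∅)
    else if a ∈ Y then X.filter fun b => D b a else ∅
  have htrue : ∀ {a b}, b ∈ N true a ↔ a ∈ X ∧ b ∈ Y ∧ D a b := by
    intro a b
    by_cases h : a ∈ X <;> simp [N, h]
  have hfalse : ∀ {a b}, b ∈ N false a ↔ a ∈ Y ∧ b ∈ X ∧ D b a := by
    intro a b
    by_cases h : a ∈ Y <;> simp [N, h]
  have hsub : ∀ ε a, N ε a ⊆ nbr D ε a := by
    rintro (_ | _) a b hb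
    · simpa [nbr, inNbr] using (hfalse.1 hb).2.2
    · simpa [nbr, outNbr] using (htrue.1 hb).2.2
  refine ⟨N, ⟨?_, ?_, ?_, ?_⟩, ?_, hsub⟩
  · rintro (_ | _) a b hb
    · have := hfalse.1 hb
      exact htrue.2 ⟨this.2.1, this.1, this.2.2⟩
    · have := htrue.1 hb
      exact hfalse.2 ⟨this.2.1, this.1, this.2.2⟩
  · exact fun ε a ha => mem_nbr_of_loopless hloop _ _ (hsub _ _ ha)
  · rintro (_ | _) a ⟨b, hb⟩
    · have := (hfalse.1 hb).1
      simpa [N, this] using hY a this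
    · have := (htrue.1 hb).1
      simpa [N, this] using hX a this
  · exact fun ε ε' hab => (card_le_card (inter_subset_inter (hsub _ _) (hsub _ _))).trans
      (hfree.card_inter_le hloop ε ε' hab)
  · rintro (_ | _)
    · exact ⟨b₀, a₀, hfalse.2 ⟨hb₀, ha₀, hab₀⟩⟩
    · exact ⟨a₀, b₀, htrue.2 ⟨ha₀, hb₀, hab₀⟩⟩

section Tree

variable {W : Type*} {T : W → W → Bool}

theorem Antidirected.underG_adj (hT : Antidirected T) {u v : W} :
    (underG T).Adj u v ↔ T u v ∨ T v u := by
  rw [underG, SimpleGraph.fromRel_adj, and_iff_right_iff_imp]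
  rintro h rfl
  have h' : T u u := by simpa using h
  exact hT u u u h' h'

/-- Whether a vertex is a tail of an arc. -/
noncomputable def tailSign (T : W → W → Bool) (w : W) : Bool :=
  open Classical in decide (∃ v, T w v)

theorem tailSign_of_arc (hT : Antidirected T) {u v : W} (h : T u v) :
    tailSign T u = true ∧ tailSign T v = false := by
  simp only [tailSign, decide_eq_true_eq, decide_eq_false_iff_not]
  exact ⟨⟨v, h⟩, fun ⟨w, hw⟩ => hT u v w h hw⟩

theorem tailSign_of_adj (hT : Antidirected T) {u v : W} (h : (underG T).Adj u v) :
    tailSign T v = !tailSign T u := by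
  rcases hT.underG_adj.1 h with h | h <;> simp [tailSign_of_arc hT h]

variable [Fintype W]

theorem card_underG_neighbors_le [DecidableEq W] (hT : Antidirected T)
    [DecidableRel (underG T).Adj] (w : W) :
    (univ.filter fun y => (underG T).Adj w y).card ≤ maxDeg T := by
  refine le_trans ((card_le_card fun y hy => ?_).trans (card_union_le (outNbr T w) (inNbr T w)))
    (le_sup (f := totalDeg T) (mem_univ w))
  simpa [outNbr, inNbr, hT.underG_adj] using hy

theorem card_eq_arcCount_add_one (hT : Antidirected T) (htree : (underG T).IsTree) :
    Fintype.card W = arcCount T + 1 := by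
  classical
  rw [← htree.card_edgeFinset, arcCount]
  congr 1
  symm
  refine card_bij (fun p _ => s(p.1, p.2)) ?_ ?_ ?_
  · rintro ⟨u, v⟩ h
    simp only [mem_filter, mem_univ, true_and] at h
    simpa [hT.underG_adj] using Or.inl h
  · rintro ⟨u, v⟩ h ⟨u', v'⟩ h' heq
    simp only [mem_filter, mem_univ, true_and] at h h'
    rcases Sym2.eq_iff.1 heq with ⟨rfl, rfl⟩ | ⟨h1, h2⟩
    · rfl
    · dsimp only at h1 h2
      subst h1 h2
      exact (hT _ _ _ h h').elim
  · intro e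
    induction e with
    | _ u v =>
      intro h
      rw [SimpleGraph.mem_edgeFinset, SimpleGraph.mem_edgeSet, hT.underG_adj] at h
      rcases h with h | h
      · exact ⟨(u, v), by simpa using h, rfl⟩
      · exact ⟨(v, u), by simpa using h, Sym2.eq_swap⟩

end Tree

theorem IsHost.pos {V : Type*} [DecidableEq V] {N : Bool → V → Finset V} {k d : ℕ}
    (hN : IsHost N k d) (hk : 3 ≤ k) {ε : Bool} {a : V} (ha : (N ε a).Nonempty) : 0 < d := by
  have := hN.deg ha
  obtain ⟨b, hb, c, hc, hbc⟩ := one_lt_card.1 (show 1 < (N ε a).card by omega)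
  exact (card_pos.2 ⟨a, mem_inter.2 ⟨hN.symm hb, hN.symm hc⟩⟩).trans_le (hN.codeg _ _ hbc)

/-- If `Δ(T) ≤ ⌊k/4⌋`, then the antidirected tree `T` with `k` arcs embeds
in every `𝒦_{2,s}`-free digraph with more than `(k−1)·|V(D)|` arcs. -/
theorem stmt_12 (k : ℕ) (hk : 0 < k)
    {V : Type*} [Fintype V] [DecidableEq V]
    (D : V → V → Bool) (hloop : Loopless D)
    (hfree : K2sFree D ((k + 11) / 12))
    (harcs : (k - 1) * Fintype.card V < arcCount D)
    {W : Type*} [Fintype W] [DecidableEq W]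
    (T : W → W → Bool) (hT : Antidirected T)
    (htree : (underG T).IsTree) (hkT : arcCount T = k)
    (hD : maxDeg T ≤ k / 4) :
    Embeds T D := by
  classical
  obtain ⟨N, hN, hne, hND⟩ := exists_isHost hloop hfree harcs
  have hdeg := fun w => (card_underG_neighbors_le hT w).trans hD
  have hk4 : 4 ≤ k := by
    obtain ⟨⟨u, v⟩, huv⟩ := card_pos.1 (hkT.symm ▸ hk : 0 < arcCount T)
    have huv' : (underG T).Adj u v := hT.underG_adj.2 (.inl (by simpa using huv))
    have := (card_pos.2 ⟨v, by simpa using huv'⟩).trans_le (hdeg u)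
    omega
  have hd := hN.pos (by omega) (hne true).choose_spec
  obtain ⟨f, hf, hfN⟩ := hN.exists_embedding (by omega) (by omega) hne htree
    (hkT ▸ card_eq_arcCount_add_one hT htree) (tailSign_of_adj hT) hdeg
  refine ⟨f, hf, fun u v huv => ?_⟩
  have := hND _ _ (hfN u v (hT.underG_adj.2 (.inl huv)))
  rw [(tailSign_of_arc hT huv).1] at this
  simpa [nbr, outNbr] using this
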